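/- Let (a_n) be an arithmetic sequence and (e_n) an arithmetic-type sequence associated with (a_n), with (d_n) the associated enumeration sequence. The following are equivalent: (i) t_{(e_n)}(𝕋) ≠ t_{(d_n)}(𝕋); (ii) t_{(e_n)}(𝕋) contains an element of infinite order; (iii) t_{(e_n)}(𝕋) is uncountable; (iv) t_{(e_n)}(𝕋) has cardinality 𝔠; (v) the set difference t_{(e_n)}(𝕋) \ t_{(d_n)}(𝕋) has cardinality 𝔠. -/

import Mathlib

open Filter Topology

noncomputable section

/-- The circle group `𝕋 = ℝ/ℤ`. -/
abbrev Circle1 : Type := AddCircle (1 : ℝ)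

/-- An arithmetic sequence `(a_n)_{n ≥ 1}`, with the convention `a 0 = 1`:
a strictly increasing sequence of positive integers with `1 < a 1` and `a n ∣ a (n+1)`. -/
def IsArithSeq (a : ℕ → ℕ) : Prop :=
  a 0 = 1 ∧ StrictMono a ∧ ∀ n, a n ∣ a (n + 1)

/-- The ratio sequence: `q n = a n / a (n-1)` (so `q 1 = a 1`). -/
def ratioSeq (a : ℕ → ℕ) (n : ℕ) : ℕ := a n / a (n - 1)

/-- The subgroup of `𝕋` characterized by a sequence of integers `(u n)`. -/
def charSub (u : ℕ → ℕ) : Set Circle1 :=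
  {x : Circle1 | Tendsto (fun n => (u n) • x) atTop (nhds 0)}

/-- The set `{r·a_{k-1} : k ≥ 1, 1 ≤ r ≤ q_k - 1}` whose increasing enumeration is `(d_n)`. -/
def DSet (a : ℕ → ℕ) : Set ℕ :=
  {m | ∃ k, 1 ≤ k ∧ ∃ r, 1 ≤ r ∧ r ≤ ratioSeq a k - 1 ∧ m = r * a (k - 1)}

/-- `(d_n)` is the strictly increasing enumeration of `DSet a`. -/
def IsDSeq (a d : ℕ → ℕ) : Prop := StrictMono d ∧ Set.range d = DSet a

/-- An arithmetic-type sequence associated with the arithmetic sequence `(a_n)`: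
a strictly increasing sequence of positive integers whose set of values contains all the
values `a k` (for `k ≥ 1`) and is contained in `DSet a`. -/
def IsArithTypeSeq (a e : ℕ → ℕ) : Prop :=
  StrictMono e ∧ (∀ k, 1 ≤ k → a k ∈ Set.range e) ∧ Set.range e ⊆ DSet a

/-- `(c_n)_{n ≥ 1}` is the canonical representation of `x ∈ 𝕋` w.r.t. the arithmetic
sequence `(a_n)`: `0 ≤ c n ≤ q n - 1` for all `n ≥ 1`, `c n < q n - 1` infinitely often,
and `x = Σ_{n ≥ 1} c n / a n` in `𝕋`. -/
def IsCanonicalRep (a c : ℕ → ℕ) (x : Circle1) : Prop :=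
  (∀ n, 1 ≤ n → c n ≤ ratioSeq a n - 1) ∧
  {n | 1 ≤ n ∧ c n < ratioSeq a n - 1}.Infinite ∧
  x = ((∑' n : ℕ, (c (n + 1) : ℝ) / (a (n + 1) : ℝ) : ℝ) : Circle1)

/-- The support of a digit sequence: `supp(x) = {n ≥ 1 : c n ≠ 0}`. -/
def suppOf (c : ℕ → ℕ) : Set ℕ := {n | 1 ≤ n ∧ c n ≠ 0}

theorem two_le_ratioSeq {a : ℕ → ℕ} (ha : IsArithSeq a) (k : ℕ) : 2 ≤ ratioSeq a (k + 1) := by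
  obtain ⟨-, hm, hdvd⟩ := ha
  obtain ⟨c, hc⟩ := hdvd k
  have hlt : a k < a (k + 1) := hm (Nat.lt_succ_self k)
  have hpos : 0 < a k := Nat.pos_of_ne_zero fun h => by simp [h] at hc; omega
  have : ratioSeq a (k + 1) = c := by
    simp [ratioSeq, hc, hpos]
  rw [this]
  by_contra! h
  interval_cases c <;> omega

theorem arithSeq_succ {a : ℕ → ℕ} (ha : IsArithSeq a) (k : ℕ) :
    a (k + 1) = ratioSeq a (k + 1) * a k :=
  (Nat.div_mul_cancel (ha.2.2 k)).symm

theorem arithSeq_pos {a : ℕ → ℕ} (ha : IsArithSeq a) (k : ℕ) : 0 < a k :=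
  lt_of_lt_of_le (by rw [ha.1]; exact one_pos) (ha.2.1.monotone (Nat.zero_le k))

theorem arithSeq_dvd {a : ℕ → ℕ} (ha : IsArithSeq a) {i j : ℕ} (h : i ≤ j) : a i ∣ a j :=
  Nat.le_induction dvd_rfl (fun n _ ih => ih.trans (ha.2.2 n)) j h

theorem two_pow_mul_arithSeq_le {a : ℕ → ℕ} (ha : IsArithSeq a) (k j : ℕ) :
    2 ^ j * a k ≤ a (k + j) := by
  induction j with
  | zero => simp
  | succ j ih =>
    rw [← add_assoc, arithSeq_succ ha, pow_succ]
    calc 2 ^ j * 2 * a k = 2 * (2 ^ j * a k) := by ring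
      _ ≤ _ := Nat.mul_le_mul (two_le_ratioSeq ha _) ih

theorem mem_DSet_iff {a : ℕ → ℕ} (ha : IsArithSeq a) {m : ℕ} :
    m ∈ DSet a ↔ ∃ k r, 1 ≤ r ∧ r < ratioSeq a (k + 1) ∧ m = r * a k := by
  constructor
  · rintro ⟨k, hk, r, h1, h2, h3⟩
    obtain ⟨k, rfl⟩ := Nat.exists_eq_add_of_le' hk
    have := two_le_ratioSeq ha k
    exact ⟨k, r, h1, by omega, by simpa using h3⟩
  · rintro ⟨k, r, h1, h2, h3⟩
    exact ⟨k + 1, by omega, r, h1, by omega, by simpa using h3⟩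

theorem arithSeq_mem_DSet {a : ℕ → ℕ} (ha : IsArithSeq a) (k : ℕ) : a k ∈ DSet a :=
  (mem_DSet_iff ha).2 ⟨k, 1, le_rfl, two_le_ratioSeq ha k, by simp⟩

/-- A block `r * a k` of `DSet a` beyond `a K` has index `k ≥ K`. -/
theorem le_of_arithSeq_le_mul {a : ℕ → ℕ} (ha : IsArithSeq a) {K k r : ℕ}
    (hr : r < ratioSeq a (k + 1)) (h : a K ≤ r * a k) : K ≤ k := by
  have : r * a k < a (k + 1) := by
    rw [arithSeq_succ ha]
    exact Nat.mul_lt_mul_of_pos_right hr (arithSeq_pos ha k)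
  exact Nat.lt_succ_iff.1 (ha.2.1.lt_iff_lt.1 (h.trans_lt this))

/-- Membership in `charSub u` depends only on the set of values of `u`. -/
theorem mem_charSub_iff {u : ℕ → ℕ} (hu : StrictMono u) {x : Circle1} :
    x ∈ charSub u ↔ ∀ ε > 0, ∃ N, ∀ m ∈ Set.range u, N ≤ m → ‖m • x‖ < ε := by
  simp only [charSub, Set.mem_ofPred_eq, Metric.tendsto_atTop, dist_zero_right]
  refine forall₂_congr fun ε _ => ⟨?_, ?_⟩
  · rintro ⟨N, hN⟩
    refine ⟨u N, ?_⟩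
    rintro _ ⟨n, rfl⟩ hn
    exact hN n (hu.le_iff_le.1 hn)
  · rintro ⟨N, hN⟩
    exact ⟨N, fun n hn => hN _ ⟨n, rfl⟩ (hn.trans hu.le_apply)⟩

theorem charSub_anti {u v : ℕ → ℕ} (hu : StrictMono u) (hv : StrictMono v)
    (h : Set.range u ⊆ Set.range v) : charSub v ⊆ charSub u := by
  intro x hx
  rw [mem_charSub_iff hv] at hx
  rw [mem_charSub_iff hu]
  intro ε hε
  obtain ⟨N, hN⟩ := hx ε hε
  exact ⟨N, fun m hm => hN m (h hm)⟩

theorem exists_coe_eq_abs_eq_norm (g : Circle1) : ∃ t : ℝ, (t : Circle1) = g ∧ |t| = ‖g‖ := by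
  obtain ⟨s, rfl⟩ := QuotientAddGroup.mk_surjective g
  refine ⟨s - round s, ?_, (UnitAddCircle.norm_eq (x := s)).symm⟩
  have : ((round s : ℝ) : Circle1) = 0 :=
    (AddCircle.coe_eq_zero_iff (1 : ℝ)).2 ⟨round s, by simp⟩
  rw [AddCircle.coe_sub, this, sub_zero]

theorem norm_coe_le_abs (t : ℝ) : ‖(t : Circle1)‖ ≤ |t| := by
  rw [UnitAddCircle.norm_eq]
  simpa using round_le t 0

theorem norm_coe_eq_abs {t : ℝ} (h : |t| ≤ 1 / 2) : ‖(t : Circle1)‖ = |t| :=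
  (AddCircle.norm_coe_eq_abs_iff (1 : ℝ) one_ne_zero).2 (by simpa using h)

theorem norm_le_half (g : Circle1) : ‖g‖ ≤ 1 / 2 := by
  simpa using AddCircle.norm_le_half_period (1 : ℝ) (x := g) one_ne_zero

theorem norm_nsmul_eq_of_multiples_small (g : Circle1) (n : ℕ)
    (h : ∀ r, 1 ≤ r → r ≤ n → ‖r • g‖ ≤ 1 / 8) : ‖n • g‖ = n * ‖g‖ := by
  obtain ⟨t, rfl, ht⟩ := exists_coe_eq_abs_eq_norm g
  induction n with
  | zero => simp
  | succ n ih =>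
    have ih' := ih fun r h1 h2 => h r h1 (by omega)
    have h1 : ‖(t : Circle1)‖ ≤ 1 / 8 := by simpa using h 1 le_rfl (by omega)
    have h2 : n * ‖(t : Circle1)‖ ≤ 1 / 8 := by
      rw [← ih']
      rcases Nat.eq_zero_or_pos n with rfl | hn
      · simp
      · exact h n hn (by omega)
    have h3 : |((n + 1 : ℕ) : ℝ) * t| = ((n + 1 : ℕ) : ℝ) * ‖(t : Circle1)‖ := by
      rw [abs_mul, ht, Nat.abs_cast]
    rw [← h3, ← norm_coe_eq_abs, ← nsmul_eq_mul, AddCircle.coe_nsmul]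
    rw [h3]; push_cast; linarith

theorem eq_zero_of_doubling {s : ℕ → ℝ} (K : ℕ) (hb : ∀ k, |s k| ≤ 1 / 2)
    (h : ∀ k ≥ K, 2 * |s k| ≤ |s (k + 1)|) : s K = 0 := by
  have hpow : ∀ j, 2 ^ j * |s K| ≤ |s (K + j)| := by
    intro j
    induction j with
    | zero => simp
    | succ j ih =>
      have := h (K + j) (by omega)
      rw [← add_assoc, pow_succ]
      linarith
  by_contra hne
  have hpos : 0 < |s K| := abs_pos.2 hne
  obtain ⟨j, hj⟩ := pow_unbounded_of_one_lt (1 / |s K|) (one_lt_two)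
  rw [div_lt_iff₀ hpos] at hj
  linarith [hpow j, hb (K + j)]

theorem mem_charSub_of_nsmul_eq_zero {a u : ℕ → ℕ} (ha : IsArithSeq a) (hu : StrictMono u)
    (hr : Set.range u ⊆ DSet a) {x : Circle1} {k : ℕ} (hx : a k • x = 0) : x ∈ charSub u := by
  rw [mem_charSub_iff hu]
  refine fun ε hε => ⟨a k, fun m hm hkm => ?_⟩
  obtain ⟨j, r, -, h2, rfl⟩ := (mem_DSet_iff ha).1 (hr hm)
  obtain ⟨c, hc⟩ := arithSeq_dvd ha (le_of_arithSeq_le_mul ha h2 hkm)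
  rw [hc, show r * (a k * c) = r * c * a k by ring, mul_nsmul', hx]
  simpa using hε

theorem exists_nsmul_eq_zero_of_mem_charSub {a d : ℕ → ℕ} (ha : IsArithSeq a) (hd : IsDSeq a d)
    {x : Circle1} (hx : x ∈ charSub d) : ∃ k, a k • x = 0 := by
  obtain ⟨N, hN⟩ := (mem_charSub_iff hd.1).1 hx (1 / 8) (by norm_num)
  rw [hd.2] at hN
  refine ⟨N, norm_eq_zero.1 (eq_zero_of_doubling (s := fun k => ‖a k • x‖) N ?_ ?_)⟩
  · intro k
    rw [abs_norm]
    exact norm_le_half _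
  · intro k hk
    have hak : N ≤ a k := hk.trans ha.2.1.le_apply
    have key := norm_nsmul_eq_of_multiples_small (a k • x) (ratioSeq a (k + 1)) (by
      intro r h1 h2
      rw [← mul_nsmul']
      refine (hN _ ?_ (hak.trans (Nat.le_mul_of_pos_left _ h1))).le
      rcases h2.lt_or_eq with h2 | rfl
      · exact (mem_DSet_iff ha).2 ⟨k, r, h1, h2, rfl⟩
      · rw [← arithSeq_succ ha]
        exact arithSeq_mem_DSet ha _)
    rw [← mul_nsmul', ← arithSeq_succ ha] at key
    have h2 : (2 : ℝ) ≤ ratioSeq a (k + 1) := by exact_mod_cast two_le_ratioSeq ha k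
    simp only [abs_norm]
    rw [key]
    exact mul_le_mul_of_nonneg_right h2 (norm_nonneg _)

theorem countable_setOf_isOfFinAddOrder : {x : Circle1 | IsOfFinAddOrder x}.Countable := by
  have : {x : Circle1 | IsOfFinAddOrder x} ⊆ ⋃ n : ℕ, {x : Circle1 | (n + 1) • x = 0} := by
    intro x hx
    obtain ⟨n, hn, h⟩ := isOfFinAddOrder_iff_nsmul_eq_zero.1 hx
    obtain ⟨n, rfl⟩ := Nat.exists_eq_add_of_le' hn
    exact Set.mem_iUnion.2 ⟨n, h⟩
  exact (Set.countable_iUnion fun n =>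
    (AddCircle.finite_torsion (1 : ℝ) (Nat.succ_pos n)).countable).mono this

theorem charSub_subset_isOfFinAddOrder {a d : ℕ → ℕ} (ha : IsArithSeq a) (hd : IsDSeq a d) :
    charSub d ⊆ {x : Circle1 | IsOfFinAddOrder x} := by
  intro x hx
  obtain ⟨k, hk⟩ := exists_nsmul_eq_zero_of_mem_charSub ha hd hx
  exact isOfFinAddOrder_iff_nsmul_eq_zero.2 ⟨a k, arithSeq_pos ha k, hk⟩

/-- An integer digit sequence that is bounded relative to the ratios has a sequence of real
"tails" `z k = ∑ j, a k * b (k + j) / a (k + j + 1)`. -/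
theorem exists_tails {a : ℕ → ℕ} (ha : IsArithSeq a) (b : ℕ → ℤ) (M : ℝ)
    (hb : ∀ j, |(b j : ℝ)| ≤ M * ratioSeq a (j + 1)) :
    ∃ z : ℕ → ℝ, (∀ k, z (k + 1) = ratioSeq a (k + 1) * z k - b k) ∧
      ∀ k δ, (∀ j ≥ k, |(b j : ℝ)| ≤ δ * ratioSeq a (j + 1)) → |z k| ≤ 2 * δ := by
  have hapos : ∀ k, (0 : ℝ) < a k := fun k => by exact_mod_cast arithSeq_pos ha k
  have hQ : ∀ k, (0 : ℝ) < ratioSeq a (k + 1) := fun k => by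
    exact_mod_cast lt_of_lt_of_le two_pos (two_le_ratioSeq ha k)
  have hsucc : ∀ k, (a (k + 1) : ℝ) = ratioSeq a (k + 1) * a k := fun k => by
    exact_mod_cast arithSeq_succ ha k
  set f : ℕ → ℕ → ℝ := fun k j => a k * (b (k + j) / a (k + j + 1)) with hf
  have hbound : ∀ k δ, (∀ j ≥ k, |(b j : ℝ)| ≤ δ * ratioSeq a (j + 1)) →
      ∀ j, ‖f k j‖ ≤ δ * (1 / 2) ^ j := by
    intro k δ h j
    have h1 := h (k + j) (by omega)
    have h2 : (2 : ℝ) ^ j * a k ≤ a (k + j) := by exact_mod_cast two_pow_mul_arithSeq_le ha k j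
    have hδ : 0 ≤ δ := by
      by_contra! hneg
      have := mul_neg_of_neg_of_pos hneg (hQ (k + j))
      linarith [abs_nonneg (b (k + j) : ℝ)]
    simp only [hf, norm_mul, norm_div, Real.norm_eq_abs, Nat.abs_cast]
    calc (a k : ℝ) * (|(b (k + j) : ℝ)| / a (k + j + 1))
        ≤ a k * (δ * ratioSeq a (k + j + 1) / a (k + j + 1)) := by gcongr
      _ = δ * (a k / a (k + j)) := by
        rw [hsucc]; field_simp [(hQ (k + j)).ne', (hapos (k + j)).ne']
      _ ≤ δ * (1 / 2) ^ j := by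
        gcongr
        rw [div_le_iff₀ (hapos _), one_div, inv_pow, ← div_eq_inv_mul,
          le_div_iff₀ (by positivity)]
        linarith
  have hsum : ∀ k, Summable (f k) := fun k =>
    Summable.of_norm_bounded (summable_geometric_two.mul_left M) (hbound k M fun j _ => hb j)
  refine ⟨fun k => ∑' j, f k j, fun k => ?_, fun k δ h => ?_⟩
  · have hstep : ∀ j, f k (j + 1) = (ratioSeq a (k + 1) : ℝ)⁻¹ * f (k + 1) j := by
      intro j
      simp only [hf]
      rw [hsucc k, show k + 1 + j = k + (j + 1) by ring]
      field_simp [(hQ k).ne']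
    have hzero : f k 0 = b k / ratioSeq a (k + 1) := by
      simp only [hf, add_zero]
      rw [hsucc k]
      field_simp [(hQ k).ne', (hapos k).ne']
    have htail : ∑' j, f k (j + 1) = (ratioSeq a (k + 1) : ℝ)⁻¹ * ∑' j, f (k + 1) j := by
      rw [tsum_congr hstep]
      exact tsum_mul_left
    simp only
    rw [(hsum k).tsum_eq_zero_add, hzero, htail]
    field_simp [(hQ k).ne']
    ring
  · have := tsum_of_norm_bounded (hasSum_geometric_two.mul_left δ) (hbound k δ h)
    rw [Real.norm_eq_abs] at this
    linarith

theorem nsmul_coe_tail {a : ℕ → ℕ} (ha : IsArithSeq a) {b : ℕ → ℤ} {z : ℕ → ℝ}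
    (hz : ∀ k, z (k + 1) = ratioSeq a (k + 1) * z k - b k) (k : ℕ) :
    a k • (z 0 : Circle1) = (z k : Circle1) := by
  induction k with
  | zero => simp [ha.1]
  | succ k ih =>
    have h0 : ((b k : ℝ) : Circle1) = 0 :=
      (AddCircle.coe_eq_zero_iff (1 : ℝ)).2 ⟨b k, by simp⟩
    rw [arithSeq_succ ha, mul_nsmul', ih, hz k, AddCircle.coe_sub, h0, sub_zero, ← nsmul_eq_mul,
      AddCircle.coe_nsmul]

/-- Signed digits of a point of the circle: `y k` is the small representative of `a k • x`. -/
theorem exists_signed_digits {a : ℕ → ℕ} (ha : IsArithSeq a) (x : Circle1) :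
    ∃ (y : ℕ → ℝ) (b : ℕ → ℤ), (∀ k, (y k : Circle1) = a k • x) ∧ (∀ k, |y k| = ‖a k • x‖) ∧
      ∀ k, y (k + 1) = ratioSeq a (k + 1) * y k - b k := by
  choose y hy hyn using fun k => exists_coe_eq_abs_eq_norm (a k • x)
  have : ∀ k, ∃ b : ℤ, y (k + 1) = ratioSeq a (k + 1) * y k - b := by
    intro k
    have h : ((ratioSeq a (k + 1) * y k - y (k + 1) : ℝ) : Circle1) = 0 := by
      rw [AddCircle.coe_sub, ← nsmul_eq_mul, AddCircle.coe_nsmul, hy, hy, ← mul_nsmul',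
        ← arithSeq_succ ha, sub_self]
    obtain ⟨n, hn⟩ := (AddCircle.coe_eq_zero_iff (1 : ℝ)).1 h
    simp only [zsmul_eq_mul, mul_one] at hn
    exact ⟨n, by linarith⟩
  choose b hb using this
  exact ⟨y, b, hy, hyn, hb⟩

theorem eventually_norm_arithSeq_nsmul_lt {a e : ℕ → ℕ} (ha : IsArithSeq a) (he : IsArithTypeSeq a e)
    {x : Circle1} (hx : x ∈ charSub e) {ε : ℝ} (hε : 0 < ε) : ∃ K, ∀ k ≥ K, ‖a k • x‖ < ε := by
  obtain ⟨N, hN⟩ := (mem_charSub_iff he.1).1 hx ε hε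
  exact ⟨N + 1, fun k hk => hN _ (he.2.1 k (by omega))
    ((Nat.le_of_succ_le hk).trans ha.2.1.le_apply)⟩

theorem abs_digit_le {q : ℕ} (hq : 2 ≤ q) {y y' δ : ℝ} {b : ℤ} (h : y' = q * y - b)
    (hy : |y| ≤ δ) (hy' : |y'| ≤ δ) : |(b : ℝ)| ≤ 2 * δ * q := by
  have hq' : (2 : ℝ) ≤ q := by exact_mod_cast hq
  have hb : (b : ℝ) = q * y - y' := by linarith
  have hδ : 0 ≤ δ := (abs_nonneg y).trans hy
  calc |(b : ℝ)| ≤ |q * y| + |y'| := by rw [hb]; exact abs_sub _ _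
    _ ≤ q * δ + δ := by rw [abs_mul, Nat.abs_cast]; gcongr
    _ ≤ _ := by nlinarith

/-- Deleting signed digits of a point of `charSub e` gives again a point of `charSub e`. -/
theorem coe_tail_mem_charSub {a e : ℕ → ℕ} (ha : IsArithSeq a) (he : IsArithTypeSeq a e)
    {x : Circle1} (hx : x ∈ charSub e) {y : ℕ → ℝ} {b b' : ℕ → ℤ}
    (hy : ∀ k, (y k : Circle1) = a k • x) (hyn : ∀ k, |y k| = ‖a k • x‖)
    (hyb : ∀ k, y (k + 1) = ratioSeq a (k + 1) * y k - b k)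
    (hb' : ∀ k, b' k = b k ∨ b' k = 0) {z : ℕ → ℝ}
    (hz : ∀ k, z (k + 1) = ratioSeq a (k + 1) * z k - b' k)
    (hzb : ∀ k δ, (∀ j ≥ k, |(b' j : ℝ)| ≤ δ * ratioSeq a (j + 1)) → |z k| ≤ 2 * δ) :
    (z 0 : Circle1) ∈ charSub e := by
  rw [mem_charSub_iff he.1]
  intro ε hε
  obtain ⟨K, hK⟩ := eventually_norm_arithSeq_nsmul_lt ha he hx (ε := ε / 16) (by positivity)
  obtain ⟨N, hN⟩ := (mem_charSub_iff he.1).1 hx (ε / 4) (by positivity)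
  refine ⟨max N (a K), fun m hm hNm => ?_⟩
  have hNx := hN m hm ((le_max_left _ _).trans hNm)
  obtain ⟨k, r, h1, h2, rfl⟩ := (mem_DSet_iff ha).1 (he.2.2 hm)
  have hKk : K ≤ k := le_of_arithSeq_le_mul ha h2 ((le_max_right _ _).trans hNm)
  have hysmall : ∀ j ≥ K, |y j| ≤ ε / 16 := fun j hj => by rw [hyn]; exact (hK j hj).le
  have hzk : |z (k + 1)| ≤ 2 * (2 * (ε / 16)) := by
    refine hzb _ _ fun j hj => ?_
    rcases hb' j with h | h
    · rw [h]
      exact abs_digit_le (two_le_ratioSeq ha j) (hyb j) (hysmall j (by omega))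
        (hysmall (j + 1) (by omega))
    · simp only [h, Int.cast_zero, abs_zero]
      positivity
  have hyk := hysmall (k + 1) (by omega)
  rw [mul_nsmul', nsmul_coe_tail ha hz, ← AddCircle.coe_nsmul, nsmul_eq_mul]
  rw [mul_nsmul', ← hy, ← AddCircle.coe_nsmul, nsmul_eq_mul] at hNx
  have hqpos : (0 : ℝ) < ratioSeq a (k + 1) := by exact_mod_cast (by omega : 0 < _)
  have hfrac : ∀ t : ℝ, |(r : ℝ) / ratioSeq a (k + 1) * t| ≤ |t| := by
    intro t
    rw [abs_mul]
    refine mul_le_of_le_one_left (abs_nonneg t) ?_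
    rw [abs_of_nonneg (by positivity), div_le_one hqpos]
    exact_mod_cast h2.le
  rcases hb' k with h | h
  · have hdecomp : (r : ℝ) * z k =
        r * y k + (r : ℝ) / ratioSeq a (k + 1) * (z (k + 1) - y (k + 1)) := by
      rw [hz, hyb, h]
      field_simp
      ring
    rw [hdecomp, AddCircle.coe_add]
    have e1 := (norm_coe_le_abs _).trans (hfrac (z (k + 1) - y (k + 1)))
    have e2 := abs_sub (z (k + 1)) (y (k + 1))
    have e3 := norm_add_le ((r * y k : ℝ) : Circle1)
      (((r : ℝ) / ratioSeq a (k + 1) * (z (k + 1) - y (k + 1)) : ℝ) : Circle1)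
    linarith
  · have hdecomp : (r : ℝ) * z k = (r : ℝ) / ratioSeq a (k + 1) * z (k + 1) := by
      rw [hz, h]
      field_simp
      simp
    rw [hdecomp]
    have e1 := (norm_coe_le_abs _).trans (hfrac (z (k + 1)))
    linarith

/-- Points with small signed digits have unique digits. -/
theorem digits_eq_of_coe_tail_eq {a : ℕ → ℕ} (ha : IsArithSeq a) {b b' : ℕ → ℤ} {z z' : ℕ → ℝ}
    (hz : ∀ k, z (k + 1) = ratioSeq a (k + 1) * z k - b k)
    (hz' : ∀ k, z' (k + 1) = ratioSeq a (k + 1) * z' k - b' k)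
    (hs : ∀ k, |z k| ≤ 1 / 4) (hs' : ∀ k, |z' k| ≤ 1 / 4)
    (h : (z 0 : Circle1) = (z' 0 : Circle1)) : b = b' := by
  have hzz : ∀ k, z k = z' k := by
    intro k
    have hk : (z k : Circle1) = z' k := by
      rw [← nsmul_coe_tail ha hz, ← nsmul_coe_tail ha hz', h]
    have h0 : ((z k - z' k : ℝ) : Circle1) = 0 := by rw [AddCircle.coe_sub, hk, sub_self]
    have habs : |z k - z' k| ≤ 1 / 2 := by
      linarith [abs_sub (z k) (z' k), hs k, hs' k]
    have := norm_coe_eq_abs habs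
    rw [h0, norm_zero] at this
    exact sub_eq_zero.1 (abs_eq_zero.1 this.symm)
  funext k
  have h1 := hz k
  have h2 := hz' k
  rw [hzz, hzz, h2] at h1
  have : (b k : ℝ) = b' k := by linarith
  exact_mod_cast this

theorem infinite_support_digits {a : ℕ → ℕ} (ha : IsArithSeq a) {x : Circle1}
    (hx : ∀ k, a k • x ≠ 0) {y : ℕ → ℝ} {b : ℕ → ℤ} (hyn : ∀ k, |y k| = ‖a k • x‖)
    (hyb : ∀ k, y (k + 1) = ratioSeq a (k + 1) * y k - b k) (K : ℕ) :
    {k | K ≤ k ∧ b k ≠ 0}.Infinite := by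
  intro hfin
  obtain ⟨B, hB⟩ := hfin.bddAbove
  have hy0 : y (max K (B + 1)) = 0 := by
    refine eq_zero_of_doubling _ (fun k => ?_) fun k hk => ?_
    · rw [hyn]
      exact norm_le_half _
    · have hbk : b k = 0 := by
        by_contra hne
        have : k ≤ B := hB ⟨(le_max_left _ _).trans hk, hne⟩
        omega
      have h2 : (2 : ℝ) ≤ ratioSeq a (k + 1) := by exact_mod_cast two_le_ratioSeq ha k
      rw [hyb, hbk, Int.cast_zero, sub_zero, abs_mul, Nat.abs_cast]
      gcongr
  have := hyn (max K (B + 1))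
  rw [hy0, abs_zero] at this
  exact hx _ (norm_eq_zero.1 this.symm)

theorem mk_le_continuum_of_circle (s : Set Circle1) : Cardinal.mk s ≤ Cardinal.continuum :=
  (Cardinal.mk_set_le s).trans <| Cardinal.mk_real ▸
    Cardinal.mk_le_of_surjective
      (QuotientAddGroup.mk_surjective (s := AddSubgroup.zmultiples (1 : ℝ)))

theorem continuum_le_mk_charSub {a e : ℕ → ℕ} (ha : IsArithSeq a) (he : IsArithTypeSeq a e)
    {x : Circle1} (hx : x ∈ charSub e) (hne : ∀ k, a k • x ≠ 0) :
    Cardinal.continuum ≤ Cardinal.mk ↥(charSub e) := by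
  classical
  obtain ⟨y, b, hy, hyn, hyb⟩ := exists_signed_digits ha x
  obtain ⟨K, hK⟩ := eventually_norm_arithSeq_nsmul_lt ha he hx (ε := 1 / 16) (by norm_num)
  set S : Set ℕ := {k | K ≤ k ∧ b k ≠ 0}
  have hSinf : S.Infinite := infinite_support_digits ha hne hyn hyb K
  let β : 𝒫 S → ℕ → ℤ := fun A k => if k ∈ A.1 then b k else 0
  have hβ : ∀ A k, |(β A k : ℝ)| ≤ 1 / 8 * ratioSeq a (k + 1) := by
    intro A k
    simp only [β]
    split_ifs with h
    · have hk : K ≤ k := (A.2 h).1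
      have := abs_digit_le (δ := 1 / 16) (two_le_ratioSeq ha k) (hyb k)
        (by rw [hyn]; exact (hK k hk).le) (by rw [hyn]; exact (hK (k + 1) (by omega)).le)
      linarith
    · simp only [Int.cast_zero, abs_zero]
      positivity
  choose z hz hzb using fun A => exists_tails ha (β A) (1 / 8) (hβ A)
  have hmem : ∀ A, (z A 0 : Circle1) ∈ charSub e := fun A =>
    coe_tail_mem_charSub ha he hx hy hyn hyb
      (fun k => by simp only [β]; split_ifs <;> simp) (hz A) (hzb A)
  have hquarter : ∀ A k, |z A k| ≤ 1 / 4 := fun A k =>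
    (hzb A k (1 / 8) fun j _ => hβ A j).trans (by norm_num)
  have hinj : Function.Injective fun A : 𝒫 S => (⟨(z A 0 : Circle1), hmem A⟩ : charSub e) := by
    intro A B hAB
    have hβeq := digits_eq_of_coe_tail_eq ha (hz A) (hz B) (hquarter A) (hquarter B)
      (congrArg Subtype.val hAB)
    have hiff : ∀ (A : 𝒫 S) k, k ∈ A.1 ↔ β A k ≠ 0 := by
      intro A k
      simp only [β]
      split_ifs with h
      · simpa [h] using (A.2 h).2
      · simp [h]
    ext k
    rw [hiff, hiff, hβeq]
  have hcard := Cardinal.mk_le_of_injective hinj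
  have : Infinite S := hSinf.to_subtype
  rwa [Cardinal.mk_powerset, Cardinal.mk_eq_aleph0, Cardinal.two_power_aleph0] at hcard

/-- the five conditions on `t_{(e_n)}(𝕋)` are equivalent. -/
theorem charSub_tfae (a d e : ℕ → ℕ) (ha : IsArithSeq a) (hd : IsDSeq a d)
    (he : IsArithTypeSeq a e) :
    List.TFAE
      [charSub e ≠ charSub d,
       ∃ x ∈ charSub e, ¬ IsOfFinAddOrder x,
       ¬ (charSub e).Countable,
       Cardinal.mk ↥(charSub e) = Cardinal.continuum,
       Cardinal.mk ↥(charSub e \ charSub d) = Cardinal.continuum] := by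
  tfae_have 1 → 5 := by
    intro hne
    have hsub : charSub d ⊆ charSub e := charSub_anti he.1 hd.1 (he.2.2.trans hd.2.ge)
    obtain ⟨x, hxe, hxd⟩ : ∃ x ∈ charSub e, x ∉ charSub d := by
      by_contra! h
      exact hne (Set.Subset.antisymm h hsub)
    have hle := continuum_le_mk_charSub ha he hxe fun k hk =>
      hxd (mem_charSub_of_nsmul_eq_zero ha hd.1 hd.2.le hk)
    refine (mk_le_continuum_of_circle _).antisymm ?_
    by_contra! hlt
    have hd_lt : Cardinal.mk ↥(charSub d) < Cardinal.continuum :=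
      (Cardinal.le_aleph0_iff_set_countable.2 (countable_setOf_isOfFinAddOrder.mono
        (charSub_subset_isOfFinAddOrder ha hd))).trans_lt Cardinal.aleph0_lt_continuum
    exact absurd (hle.trans (Cardinal.le_mk_sdiff_add_mk _ _))
      (Cardinal.add_lt_of_lt Cardinal.aleph0_le_continuum hlt hd_lt).not_ge
  tfae_have 5 → 4 := fun h =>
    (mk_le_continuum_of_circle _).antisymm (h ▸ Cardinal.mk_le_mk_of_subset Set.sdiff_subset)
  tfae_have 4 → 3 := by
    intro h hc
    rw [← Cardinal.le_aleph0_iff_set_countable, h] at hc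
    exact hc.not_gt Cardinal.aleph0_lt_continuum
  tfae_have 3 → 2 := by
    intro h
    by_contra! hfin
    exact h (countable_setOf_isOfFinAddOrder.mono hfin)
  tfae_have 2 → 1 := by
    rintro ⟨x, hx, hinf⟩ heq
    exact hinf (charSub_subset_isOfFinAddOrder ha hd (heq ▸ hx))
  tfae_finish
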